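/- Let E be a finite-dimensional real inner product space, Q ⊆ E an open convex set, p ≥ 2 an integer, and V : Q → E a p-times continuously differentiable map such that κ_{DV}(r) (if p = 2) resp. κ_{D^{p−1}V}(r) (if p ≥ 3) is finite for all relevant r. Define τ(r) = κ_{DV}(r) if p = 2 and τ(r) = (1/(p−3)!) ∫₀^r (r−t)^{p−3} κ_{D^{p−1}V}(t) dt if p ≥ 3. Then for all x, y ∈ Q one has ‖DV(y) − D T^p_x(y)‖_op ≤ τ(‖y − x‖), where D T^p_x(y) is the derivative of the Taylor polynomial at y and ‖·‖_op the operator norm. -/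

import Mathlib

open Set

variable {E : Type*} [NormedAddCommGroup E] [InnerProductSpace ℝ E] [FiniteDimensional ℝ E]

/-- The defining set of the global curvature bound `κ_{D^q V}(r)` of the `q`-th derivative
of `V` on `Q`. -/
def curvSet (Q : Set E) (V : E → E) (q : ℕ) (r : ℝ) : Set ℝ :=
  {v | ∃ x ∈ Q, ∃ y ∈ Q, ∃ t ∈ Ioo (0 : ℝ) 1, ‖y - x‖ ≤ r ∧
    v = ‖t • iteratedFDerivWithin ℝ q V Q y + (1 - t) • iteratedFDerivWithin ℝ q V Q x
        - iteratedFDerivWithin ℝ q V Q (x + t • (y - x))‖ / (t * (1 - t))}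

/-- The global curvature bound `κ_{D^q V}(r)` of the `q`-th derivative of `V` on `Q`. -/
noncomputable def curv (Q : Set E) (V : E → E) (q : ℕ) (r : ℝ) : ℝ :=
  sSup (curvSet Q V q r)

section Taylor

variable {X F : Type*} [NormedAddCommGroup X] [NormedSpace ℝ X] [NormedAddCommGroup F]
  [NormedSpace ℝ F]

theorem norm_sub_sub_fderiv_le_of_chord_bound {G : X → F} {x y : X} {C : ℝ}
    (hG : DifferentiableAt ℝ G x)
    (hC : ∀ t ∈ Ioo (0 : ℝ) 1,
      ‖t • G y + (1 - t) • G x - G (x + t • (y - x))‖ ≤ C * (t * (1 - t))) :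
    ‖G y - G x - fderiv ℝ G x (y - x)‖ ≤ C := by
  have hd : HasDerivAt (fun t : ℝ => G (x + t • (y - x))) (fderiv ℝ G x (y - x)) 0 := by
    have h1 : HasDerivAt (fun t : ℝ => x + t • (y - x)) (y - x) 0 := by
      simpa using ((hasDerivAt_id (0 : ℝ)).smul_const (y - x)).const_add x
    have h2 : HasFDerivAt G (fderiv ℝ G x) (x + (0 : ℝ) • (y - x)) := by
      simpa using hG.hasFDerivAt
    exact h2.comp_hasDerivAt (0 : ℝ) h1
  have hs := hd.tendsto_slope_zero_right
  simp only [zero_add, zero_smul, add_zero] at hs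
  have hl : Filter.Tendsto (fun t : ℝ => ‖G y - G x - t⁻¹ • (G (x + t • (y - x)) - G x)‖)
      (nhdsWithin 0 (Ioi 0)) (nhds ‖G y - G x - fderiv ℝ G x (y - x)‖) :=
    (tendsto_const_nhds.sub hs).norm
  have hr : Filter.Tendsto (fun t : ℝ => C * (1 - t)) (nhdsWithin 0 (Ioi 0)) (nhds C) := by
    have : Continuous fun t : ℝ => C * (1 - t) := by fun_prop
    simpa using (this.tendsto 0).mono_left nhdsWithin_le_nhds
  refine le_of_tendsto_of_tendsto hl hr ?_
  filter_upwards [Ioo_mem_nhdsGT (zero_lt_one (α := ℝ))] with t ht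
  have ht0 : 0 < t := ht.1
  have key : G y - G x - t⁻¹ • (G (x + t • (y - x)) - G x)
      = t⁻¹ • (t • G y + (1 - t) • G x - G (x + t • (y - x))) := by
    simp only [smul_sub, smul_add, smul_smul, sub_smul, one_smul, inv_mul_cancel₀ ht0.ne']
    abel
  rw [key, norm_smul, Real.norm_of_nonneg (by positivity), inv_mul_le_iff₀ ht0]
  linarith [hC t ht]

theorem ContDiffAt.iteratedFDeriv_update_const_eq {n : ℕ} {f : X → F} {x : X}
    (hf : ContDiffAt ℝ (n + 1 : ℕ) f x) (i j : Fin (n + 1)) (h v : X) :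
    iteratedFDeriv ℝ (n + 1) f x (Function.update (fun _ => h) i v) =
      iteratedFDeriv ℝ (n + 1) f x (Function.update (fun _ => h) j v) := by
  induction n generalizing x with
  | zero => rw [Fin.fin_one_eq_zero i, Fin.fin_one_eq_zero j]
  | succ n ih =>
    have hcd : ∀ᶠ y in nhds x, ContDiffAt ℝ (n + 2 : ℕ) f y := hf.eventually (by simp)
    have hdiff : DifferentiableAt ℝ (iteratedFDeriv ℝ (n + 1) f) x :=
      hf.differentiableAt_iteratedFDeriv (by norm_cast; omega)
    have hsucc : ∀ k l : Fin (n + 1),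
        iteratedFDeriv ℝ (n + 2) f x (Function.update (fun _ => h) k.succ v) =
          iteratedFDeriv ℝ (n + 2) f x (Function.update (fun _ => h) l.succ v) := by
      intro k l
      rw [hdiff.iteratedFDeriv_succ_apply_left', hdiff.iteratedFDeriv_succ_apply_left']
      simp only [Fin.tail_update_succ]
      have : (fun y => iteratedFDeriv ℝ (n + 1) f y (Function.update (fun _ => h) k v))
          =ᶠ[nhds x] fun y => iteratedFDeriv ℝ (n + 1) f y (Function.update (fun _ => h) l v) := by
        filter_upwards [hcd] with y hy
        exact ih (hy.of_le (by norm_cast; omega)) k l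
      have htail : Fin.tail (fun _ : Fin (n + 2) => h) = fun _ => h := rfl
      rw [htail, this.fderiv_eq]
      simp [Function.update_of_ne (Fin.succ_ne_zero _).symm]
    have hzero : iteratedFDeriv ℝ (n + 2) f x (Function.update (fun _ => h) 0 v) =
        iteratedFDeriv ℝ (n + 2) f x (Function.update (fun _ => h) 1 v) := by
      have hg : ContDiffAt ℝ 2 (iteratedFDeriv ℝ n f) x :=
        hf.iteratedFDeriv_right (by norm_cast; omega)
      have hsymm := hg.isSymmSndFDerivAt (by simp)
      have hexp : ∀ m : Fin (n + 2) → X, iteratedFDeriv ℝ (n + 2) f x m =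
          fderiv ℝ (fderiv ℝ (iteratedFDeriv ℝ n f)) x (m 0) (m 1) (fun i => m i.succ.succ) := by
        intro m
        have hg1 : ∀ᶠ y in nhds x, DifferentiableAt ℝ (iteratedFDeriv ℝ n f) y := by
          filter_upwards [hcd] with y hy
          exact hy.differentiableAt_iteratedFDeriv (by norm_cast; omega)
        have heq : (fun y => iteratedFDeriv ℝ (n + 1) f y (Fin.tail m)) =ᶠ[nhds x]
            fun y => fderiv ℝ (iteratedFDeriv ℝ n f) y (m 1) (fun i => m i.succ.succ) := by
          filter_upwards with y
          rfl
        have hg2 : DifferentiableAt ℝ (fderiv ℝ (iteratedFDeriv ℝ n f)) x :=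
          (hg.fderiv_right (m := 1) (by norm_num)).differentiableAt (by norm_num)
        rw [hdiff.iteratedFDeriv_succ_apply_left', heq.fderiv_eq]
        have h1 := (hg2.hasFDerivAt.clm_apply (hasFDerivAt_const (m 1) x))
        have h2 := h1.continuousMultilinear_apply_const (fun i => m i.succ.succ)
        rw [h2.fderiv]
        simp
      rw [hexp, hexp]
      have := hsymm v h
      simp only [Function.update_self, ne_eq, one_ne_zero, zero_ne_one, not_false_eq_true,
        Function.update_of_ne]
      rw [this]
      congr 1
    have hall : ∀ k : Fin (n + 2), iteratedFDeriv ℝ (n + 2) f x (Function.update (fun _ => h) k v) =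
        iteratedFDeriv ℝ (n + 2) f x (Function.update (fun _ => h) 1 v) := by
      intro k
      refine Fin.cases hzero (fun k => ?_) k
      exact hsucc k 0
    rw [hall i, hall j]

theorem ContDiffAt.hasFDerivAt_taylor {n : ℕ} {f : X → F} {x : X}
    (hf : ContDiffAt ℝ (n + 1 : ℕ) f x) (y : X) :
    HasFDerivAt (fun z => ∑ k ∈ Finset.range (n + 2),
        (Nat.factorial k : ℝ)⁻¹ • iteratedFDeriv ℝ k f x (fun _ => z - x))
      (∑ k ∈ Finset.range (n + 1),
        (Nat.factorial k : ℝ)⁻¹ • iteratedFDeriv ℝ k (fderiv ℝ f) x (fun _ => y - x)) y := by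
  simp only [Finset.sum_range_succ' _ (n + 1)]
  simp only [iteratedFDeriv_zero_apply]
  refine HasFDerivAt.add_const _ (HasFDerivAt.fun_sum fun k hk => ?_)
  rw [Finset.mem_range] at hk
  have hm := (HasFDerivAt.multilinear_comp (iteratedFDeriv ℝ (k + 1) f x)
    (fun _ : Fin (k + 1) => (hasFDerivAt_id (𝕜 := ℝ) y).sub_const x)).const_smul
    (Nat.factorial (k + 1) : ℝ)⁻¹
  refine hm.congr_fderiv ?_
  ext v
  have hfk : ContDiffAt ℝ (k + 1 : ℕ) f x := hf.of_le (by norm_cast)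
  have hterm : ∀ i : Fin (k + 1),
      iteratedFDeriv ℝ (k + 1) f x (Function.update (fun _ => y - x) i v) =
        iteratedFDeriv ℝ k (fderiv ℝ f) x (fun _ => y - x) v := fun i => by
    rw [hfk.iteratedFDeriv_update_const_eq i (Fin.last k), iteratedFDeriv_succ_apply_right,
      Fin.init_update_last, Function.update_self]
    rfl
  simp [ContinuousMultilinearMap.toContinuousLinearMap, hterm]
  rw [Nat.factorial_succ, ← Nat.cast_smul_eq_nsmul ℝ, smul_smul]
  congr 1
  push_cast
  field_simp

theorem norm_sub_taylor_le_integral [CompleteSpace F] {m : ℕ} {W : X → F} {x h : X} {K : ℝ → ℝ}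
    (hW : ∀ t ∈ Icc (0 : ℝ) 1, ContDiffAt ℝ (m + 1) W (x + t • h))
    (hK : MonotoneOn K (Icc 0 ‖h‖))
    (hb : ∀ t ∈ Icc (0 : ℝ) 1, ‖iteratedFDeriv ℝ (m + 1) W (x + t • h) (fun _ => h)
      - iteratedFDeriv ℝ (m + 1) W x (fun _ => h)
      - t • iteratedFDeriv ℝ (m + 2) W x (fun _ => h)‖ ≤ K (t * ‖h‖) * ‖h‖ ^ (m + 1)) :
    ‖W (x + h) - ∑ k ∈ Finset.range (m + 3),
        (Nat.factorial k : ℝ)⁻¹ • iteratedFDeriv ℝ k W x (fun _ => h)‖ ≤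
      1 / (Nat.factorial m : ℝ) * ∫ t in (0 : ℝ)..‖h‖, (‖h‖ - t) ^ m * K t := by
  set A := iteratedFDeriv ℝ (m + 1) W x (fun _ => h) with hA
  set B := iteratedFDeriv ℝ (m + 2) W x (fun _ => h) with hB
  set D := fun t : ℝ => iteratedFDeriv ℝ (m + 1) W (x + t • h) (fun _ => h) with hD
  have hDc : ContinuousOn D (uIcc 0 1) := by
    rw [uIcc_of_le zero_le_one]
    intro t ht
    have h1 : ContinuousAt (iteratedFDeriv ℝ (m + 1) W) (x + t • h) :=
      (hW t ht).continuousAt_iteratedFDeriv (by norm_cast)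
    exact (h1.comp (x := t) (by fun_prop)).continuousWithinAt.eval_const _
  have hi0 : ∫ t in (0 : ℝ)..1, (1 - t) ^ m = ((m : ℝ) + 1)⁻¹ := by
    have := intervalIntegral.integral_comp_sub_left (fun t : ℝ => t ^ m) (1 : ℝ) (a := 0) (b := 1)
    rw [this]
    simp
  have hi1 : ∫ t in (0 : ℝ)..1, (1 - t) ^ m * t = (((m : ℝ) + 1) * (m + 2))⁻¹ := by
    have := intervalIntegral.integral_comp_sub_left (fun t : ℝ => t ^ m * (1 - t)) (1 : ℝ)
      (a := 0) (b := 1)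
    simp only [sub_sub_cancel] at this
    rw [this]
    have h2 : ∀ t : ℝ, t ^ m * (1 - t) = t ^ m - t ^ (m + 1) := fun t => by ring
    simp only [h2, sub_self, sub_zero]
    rw [intervalIntegral.integral_sub ((continuous_pow m).intervalIntegrable _ _)
      ((continuous_pow (m + 1)).intervalIntegrable _ _)]
    simp
    field_simp
    ring
  have hrem : W (x + h) - ∑ k ∈ Finset.range (m + 3),
        (Nat.factorial k : ℝ)⁻¹ • iteratedFDeriv ℝ k W x (fun _ => h) =
      (Nat.factorial m : ℝ)⁻¹ • ∫ t in (0 : ℝ)..1, (1 - t) ^ m • (D t - A - t • B) := by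
    have hsplit : ∫ t in (0 : ℝ)..1, (1 - t) ^ m • (D t - A - t • B) =
        (∫ t in (0 : ℝ)..1, (1 - t) ^ m • D t) - ((m : ℝ) + 1)⁻¹ • A
          - (((m : ℝ) + 1) * (m + 2))⁻¹ • B := by
      rw [← hi0, ← hi1, ← intervalIntegral.integral_smul_const,
        ← intervalIntegral.integral_smul_const,
        ← intervalIntegral.integral_sub, ← intervalIntegral.integral_sub]
      · simp only [smul_sub, smul_smul]
      · exact ContinuousOn.intervalIntegrable (by fun_prop)
      · exact ContinuousOn.intervalIntegrable (by fun_prop)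
      · exact ContinuousOn.intervalIntegrable (by fun_prop)
      · exact ContinuousOn.intervalIntegrable (by fun_prop)
    rw [map_add_eq_sum_add_integral_iteratedFDeriv hW, hsplit,
      Finset.sum_range_succ _ (m + 2), Finset.sum_range_succ _ (m + 1), ← hA, ← hB]
    have e1 : (Nat.factorial (m + 1) : ℝ)⁻¹ = (Nat.factorial m : ℝ)⁻¹ * ((m : ℝ) + 1)⁻¹ := by
      rw [Nat.factorial_succ]; push_cast; rw [mul_inv, mul_comm]
    have e2 : (Nat.factorial (m + 2) : ℝ)⁻¹ =
        (Nat.factorial m : ℝ)⁻¹ * (((m : ℝ) + 1) * (m + 2))⁻¹ := by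
      rw [Nat.factorial_succ, Nat.factorial_succ]; push_cast; field_simp; ring
    rw [e1, e2]
    simp only [smul_sub, smul_smul]
    abel
  have hint : IntervalIntegrable (fun t => (‖h‖ - t) ^ m * K t) MeasureTheory.volume 0 ‖h‖ := by
    refine IntervalIntegrable.continuousOn_mul ?_ (by fun_prop)
    exact MonotoneOn.intervalIntegrable (by rwa [uIcc_of_le (norm_nonneg h)])
  have hint1 : IntervalIntegrable (fun t => (1 - t) ^ m * (K (t * ‖h‖) * ‖h‖ ^ (m + 1)))
      MeasureTheory.volume 0 1 := by
    refine IntervalIntegrable.continuousOn_mul (IntervalIntegrable.mul_const ?_ _) (by fun_prop)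
    refine MonotoneOn.intervalIntegrable ?_
    rw [uIcc_of_le zero_le_one]
    intro s hs t ht hst
    exact hK ⟨by have := hs.1; positivity, mul_le_of_le_one_left (norm_nonneg h) hs.2⟩
      ⟨by have := ht.1; positivity, mul_le_of_le_one_left (norm_nonneg h) ht.2⟩ (by gcongr)
  have hscale : ∫ t in (0 : ℝ)..1, (1 - t) ^ m * (K (t * ‖h‖) * ‖h‖ ^ (m + 1)) =
      ∫ t in (0 : ℝ)..‖h‖, (‖h‖ - t) ^ m * K t := by
    have := intervalIntegral.mul_integral_comp_mul_right (a := 0) (b := 1) ‖h‖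
      (f := fun t => (‖h‖ - t) ^ m * K t)
    rw [zero_mul, one_mul] at this
    rw [← this, ← intervalIntegral.integral_const_mul]
    congr 1
    ext t
    have : ‖h‖ - t * ‖h‖ = (1 - t) * ‖h‖ := by ring
    rw [this, mul_pow]
    ring
  rw [hrem, norm_smul, norm_inv, Real.norm_natCast, one_div, ← hscale]
  gcongr
  refine intervalIntegral.norm_integral_le_of_norm_le zero_le_one ?_ hint1
  filter_upwards with t ht
  have h1 : (0 : ℝ) ≤ 1 - t := by linarith [ht.2]
  rw [norm_smul, norm_pow, Real.norm_of_nonneg h1]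
  gcongr
  exact hb t (Ioc_subset_Icc_self ht)

end Taylor

section Curvature

variable {Y : Type*} [NormedAddCommGroup Y] [InnerProductSpace ℝ Y]

theorem norm_chord_sub_le_curv {Q : Set Y} {V : Y → Y} {q : ℕ} {r : ℝ}
    (hb : BddAbove (curvSet Q V q r)) {x y : Y} (hx : x ∈ Q) (hy : y ∈ Q) (hr : ‖y - x‖ ≤ r)
    {t : ℝ} (ht : t ∈ Ioo (0 : ℝ) 1) :
    ‖t • iteratedFDerivWithin ℝ q V Q y + (1 - t) • iteratedFDerivWithin ℝ q V Q x
        - iteratedFDerivWithin ℝ q V Q (x + t • (y - x))‖ ≤ curv Q V q r * (t * (1 - t)) := by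
  have hpos : 0 < t * (1 - t) := mul_pos ht.1 (sub_pos.2 ht.2)
  rw [← div_le_iff₀ hpos]
  exact le_csSup hb ⟨x, hx, y, hy, t, ht, hr, rfl⟩

theorem monotoneOn_curv {Q : Set Y} (hQ : Q.Nonempty) {V : Y → Y} {q : ℕ}
    (hb : ∀ r : ℝ, 0 ≤ r → BddAbove (curvSet Q V q r)) :
    MonotoneOn (curv Q V q) (Ici 0) := by
  intro r hr s hs hrs
  obtain ⟨x, hx⟩ := hQ
  refine csSup_le_csSup (hb s hs) ?_ ?_
  · exact ⟨_, x, hx, x, hx, 1 / 2, by norm_num, by simpa using hr, rfl⟩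
  · rintro v ⟨x, hx, y, hy, t, ht, hxy, rfl⟩
    exact ⟨x, hx, y, hy, t, ht, hxy.trans hrs, rfl⟩

theorem norm_iteratedFDeriv_fderiv_sub_sub_le_curv {Q : Set Y} (hQo : IsOpen Q)
    (hQc : Convex ℝ Q) {V : Y → Y} {k : ℕ} (hV : ContDiffOn ℝ (k + 2 : ℕ) V Q) {r : ℝ}
    (hb : BddAbove (curvSet Q V (k + 1) r)) {x y : Y} (hx : x ∈ Q) (hy : y ∈ Q)
    (hr : ‖y - x‖ ≤ r) :
    ‖iteratedFDeriv ℝ k (fderiv ℝ V) y - iteratedFDeriv ℝ k (fderiv ℝ V) x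
      - fderiv ℝ (iteratedFDeriv ℝ k (fderiv ℝ V)) x (y - x)‖ ≤ curv Q V (k + 1) r := by
  have hW : ContDiffAt ℝ (k + 1 : ℕ) (fderiv ℝ V) x :=
    (hV.contDiffAt (hQo.mem_nhds hx)).fderiv_right (by norm_cast)
  refine norm_sub_sub_fderiv_le_of_chord_bound
    (hW.differentiableAt_iteratedFDeriv (by norm_cast; omega)) fun t ht => ?_
  have hz : x + t • (y - x) ∈ Q := hQc.add_smul_sub_mem hx hy (Ioo_subset_Icc_self ht)
  have h := norm_chord_sub_le_curv hb hx hy hr ht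
  have hI : ∀ z ∈ Q, iteratedFDerivWithin ℝ (k + 1) V Q z =
      (continuousMultilinearCurryRightEquiv' ℝ k Y Y).symm
        (iteratedFDeriv ℝ k (fderiv ℝ V) z) := fun z hz => by
    rw [iteratedFDerivWithin_of_isOpen _ hQo hz]
    ext m
    simp [iteratedFDeriv_succ_apply_right]
  rwa [hI x hx, hI y hy, hI _ hz, ← map_smul, ← map_smul, ← map_add, ← LinearIsometryEquiv.map_sub,
    LinearIsometryEquiv.norm_map] at h

end Curvature

/-- Derivative Taylor-remainder bound:
`‖DV(y) − D T^p_x(y)‖ ≤ τ(‖y−x‖)` with `τ = κ_{DV}` for `p = 2` and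
`τ(r) = (1/(p−3)!) ∫₀^r (r−t)^{p−3} κ_{D^{p−1}V}(t) dt` for `p ≥ 3`. -/
theorem taylor_derivative_remainder_bound
    (Q : Set E) (hQo : IsOpen Q) (hQc : Convex ℝ Q)
    (p : ℕ) (hp : 2 ≤ p) (V : E → E) (hV : ContDiffOn ℝ p V Q)
    (hfin : ∀ r : ℝ, 0 ≤ r → BddAbove (curvSet Q V (p - 1) r))
    (τ : ℝ → ℝ)
    (hτ₁ : p = 2 → ∀ r : ℝ, τ r = curv Q V 1 r)
    (hτ₂ : 3 ≤ p → ∀ r : ℝ, τ r = (1 / (Nat.factorial (p - 3) : ℝ)) *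
      ∫ t in (0 : ℝ)..r, (r - t) ^ (p - 3) * curv Q V (p - 1) t) :
    ∀ x ∈ Q, ∀ y ∈ Q,
      ‖fderivWithin ℝ V Q y -
          fderiv ℝ (fun z => ∑ k ∈ Finset.range (p + 1),
            ((Nat.factorial k : ℝ))⁻¹ • iteratedFDerivWithin ℝ k V Q x (fun _ => z - x)) y‖
        ≤ τ ‖y - x‖ := by
  obtain ⟨k, rfl⟩ : ∃ k, p = k + 2 := ⟨p - 2, by omega⟩
  intro x hx y hy
  have hVx : ContDiffAt ℝ (k + 2 : ℕ) V x := hV.contDiffAt (hQo.mem_nhds hx)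
  have hmem : ∀ t ∈ Icc (0 : ℝ) 1, x + t • (y - x) ∈ Q := fun t ht =>
    hQc.add_smul_sub_mem hx hy ht
  have hW : ∀ z ∈ Q, ContDiffAt ℝ (k + 1 : ℕ) (fderiv ℝ V) z := fun z hz =>
    (hV.contDiffAt (hQo.mem_nhds hz)).fderiv_right (by norm_cast)
  have hb : ∀ {r : ℝ}, 0 ≤ r → ∀ z ∈ Q, ‖z - x‖ ≤ r →
      ‖iteratedFDeriv ℝ k (fderiv ℝ V) z - iteratedFDeriv ℝ k (fderiv ℝ V) x
        - fderiv ℝ (iteratedFDeriv ℝ k (fderiv ℝ V)) x (z - x)‖ ≤ curv Q V (k + 1) r :=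
    fun hr z hz hzr =>
      norm_iteratedFDeriv_fderiv_sub_sub_le_curv hQo hQc hV (hfin _ hr) hx hz hzr
  simp only [iteratedFDerivWithin_of_isOpen _ hQo hx]
  rw [fderivWithin_of_isOpen hQo hy, (hVx.hasFDerivAt_taylor y).fderiv]
  have hdiff : DifferentiableAt ℝ (iteratedFDeriv ℝ k (fderiv ℝ V)) x :=
    (hW x hx).differentiableAt_iteratedFDeriv (by norm_cast; omega)
  have happ : ∀ z ∈ Q, ∀ h : E, ∀ t : ℝ, z - x = t • h →
      ‖iteratedFDeriv ℝ k (fderiv ℝ V) z (fun _ => h)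
        - iteratedFDeriv ℝ k (fderiv ℝ V) x (fun _ => h)
        - t • iteratedFDeriv ℝ (k + 1) (fderiv ℝ V) x (fun _ => h)‖ ≤
      curv Q V (k + 1) ‖z - x‖ * ‖h‖ ^ k := by
    intro z hz h t hzt
    have h1 : t • iteratedFDeriv ℝ (k + 1) (fderiv ℝ V) x (fun _ => h) =
        fderiv ℝ (iteratedFDeriv ℝ k (fderiv ℝ V)) x (z - x) (fun _ => h) := by
      rw [hzt, map_smul]
      rfl
    rw [h1]
    refine (ContinuousMultilinearMap.le_opNorm (iteratedFDeriv ℝ k (fderiv ℝ V) z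
      - iteratedFDeriv ℝ k (fderiv ℝ V) x
      - fderiv ℝ (iteratedFDeriv ℝ k (fderiv ℝ V)) x (z - x)) (fun _ => h)).trans ?_
    rw [Finset.prod_const, Finset.card_univ, Fintype.card_fin]
    gcongr
    exact hb (norm_nonneg _) z hz le_rfl
  cases k with
  | zero =>
    rw [hτ₁ rfl]
    simpa [Finset.sum_range_succ, sub_sub] using happ y hy (y - x) 1 (by simp)
  | succ m =>
    rw [hτ₂ (by omega)]
    have hK : MonotoneOn (curv Q V (m + 2)) (Icc 0 ‖y - x‖) :=
      (monotoneOn_curv ⟨x, hx⟩ hfin).mono Icc_subset_Ici_self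
    have h := norm_sub_taylor_le_integral (m := m) (W := fderiv ℝ V) (x := x) (h := y - x)
      (fun t ht => (hW _ (hmem t ht)).of_le (by norm_cast; omega)) hK fun t ht => by
        have h2 := happ _ (hmem t ht) (y - x) t (by simp)
        rwa [add_sub_cancel_left, norm_smul, Real.norm_of_nonneg ht.1] at h2
    rwa [add_sub_cancel] at h
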